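/- For all integers k ≥ 2 and M ≥ 1, the combinatorial sum satisfies ∑_{q=1}^{k−1} C(k−1, q) · C(M, k−q) ≤ (M^k / (k−1)!) · e^{(k−1)²/M}, where C(a,b) denotes the binomial coefficient and e is Euler's number. -/

import Mathlib

theorem choose_succ_mul_choose_le (n M q : ℕ) (hM : 1 ≤ M) (hq : q < n) :
    (n.choose (q + 1) : ℝ) * (M.choose (n - q) : ℝ) ≤
      (M : ℝ) ^ (n + 1) / (n.factorial : ℝ) *
        (((n : ℝ) ^ 2 / M) ^ (q + 1) / ((q + 1).factorial : ℝ)) := by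
  have hM0 : (0 : ℝ) < M := by exact_mod_cast hM
  have hn1 : (1 : ℝ) ≤ n := by exact_mod_cast (by omega : 1 ≤ n)
  have hfac : (n.factorial : ℝ) ≤ (n - q).factorial * (n : ℝ) ^ (q + 1) := by
    calc (n.factorial : ℝ) = (n - q).factorial * n.descFactorial q := by
          exact_mod_cast (Nat.factorial_mul_descFactorial hq.le).symm
      _ ≤ (n - q).factorial * (n : ℝ) ^ q := by
          gcongr
          exact_mod_cast Nat.descFactorial_le_pow n q
      _ ≤ (n - q).factorial * (n : ℝ) ^ (q + 1) := by
          gcongr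
          omega
  have hpow : (M : ℝ) ^ (n + 1) = (M : ℝ) ^ (n - q) * (M : ℝ) ^ (q + 1) := by
    rw [← pow_add]
    congr 1
    omega
  calc (n.choose (q + 1) : ℝ) * (M.choose (n - q) : ℝ)
      ≤ ((n : ℝ) ^ (q + 1) / (q + 1).factorial) * ((M : ℝ) ^ (n - q) / (n - q).factorial) := by
        gcongr <;> exact Nat.choose_le_pow_div _ _
    _ ≤ ((n : ℝ) ^ (q + 1) / (q + 1).factorial) *
          ((M : ℝ) ^ (n - q) * ((n : ℝ) ^ (q + 1) / n.factorial)) := by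
        rw [div_eq_mul_inv ((M : ℝ) ^ (n - q))]
        gcongr
        rw [inv_eq_one_div, div_le_div_iff₀ (by positivity) (by positivity)]
        linarith
    _ = _ := by
        rw [hpow, div_pow]
        field_simp
        ring

/-- `∑_{q=1}^{k−1} C(k−1,q) C(M,k−q) ≤ (M^k/(k−1)!) e^{(k−1)²/M}`. -/
theorem collision_count_le (k M : ℕ) (hk : 2 ≤ k) (hM : 1 ≤ M) :
    (∑ q ∈ Finset.Icc 1 (k - 1), ((k - 1).choose q : ℝ) * (M.choose (k - q) : ℝ)) ≤
      (M : ℝ) ^ k / (Nat.factorial (k - 1) : ℝ) *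
        Real.exp (((k : ℝ) - 1) ^ 2 / (M : ℝ)) := by
  obtain ⟨n, rfl⟩ : ∃ n, k = n + 1 := ⟨k - 1, by omega⟩
  simp only [Nat.add_sub_cancel, Nat.cast_add, Nat.cast_one, add_sub_cancel_right]
  calc (∑ q ∈ Finset.Icc 1 n, (n.choose q : ℝ) * (M.choose (n + 1 - q) : ℝ))
      ≤ ∑ q ∈ Finset.Icc 1 n, (M : ℝ) ^ (n + 1) / (n.factorial : ℝ) *
          (((n : ℝ) ^ 2 / M) ^ q / (q.factorial : ℝ)) := by
        refine Finset.sum_le_sum fun q hq => ?_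
        obtain ⟨h1, h2⟩ := Finset.mem_Icc.mp hq
        obtain ⟨p, rfl⟩ : ∃ p, q = p + 1 := ⟨q - 1, by omega⟩
        rw [Nat.add_sub_add_right]
        exact choose_succ_mul_choose_le n M p hM h2
    _ = (M : ℝ) ^ (n + 1) / (n.factorial : ℝ) *
          ∑ q ∈ Finset.Icc 1 n, ((n : ℝ) ^ 2 / M) ^ q / (q.factorial : ℝ) := by
        rw [Finset.mul_sum]
    _ ≤ (M : ℝ) ^ (n + 1) / (n.factorial : ℝ) *
          ∑ q ∈ Finset.range (n + 1), ((n : ℝ) ^ 2 / M) ^ q / (q.factorial : ℝ) := by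
        gcongr
        intro q hq
        have := Finset.mem_Icc.mp hq
        exact Finset.mem_range.mpr (by omega)
    _ ≤ _ := by
        gcongr
        exact Real.sum_le_exp_of_nonneg (by positivity) _
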